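/- Assume f₀ : 𝒳ⁿ → ℝⁿ is Lipschitz on bounded sets with f₀(0) = 0. The following are equivalent: (1) ẋ(t) = f₀(x_t) is GES; (2) there exist a functional V : 𝒳ⁿ → [0,∞) Lipschitz on bounded sets and constants a₁, a₂, a, p > 0 such that a₁|φ(0)|ᵖ ≤ V(φ) ≤ a₂‖φ‖ᵖ and D⁺V(φ, f₀(φ)) ≤ −a V(φ) for all φ ∈ 𝒳ⁿ; (3) there exist a functional V : 𝒳ⁿ → [0,∞) Lipschitz on bounded sets and constants a₁, a₂, a, p > 0 such that a₁‖φ‖ᵖ ≤ V(φ) ≤ a₂‖φ‖ᵖ and D⁺V(φ, f₀(φ)) ≤ −a‖φ‖ᵖ for all φ ∈ 𝒳ⁿ. -/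

import Mathlib

open Set Filter MeasureTheory Topology
open scoped NNReal

noncomputable section

/-- `ℝⁿ` with the Euclidean norm. -/
abbrev Vec (n : ℕ) : Type := EuclideanSpace ℝ (Fin n)

/-- The state space `𝒳ⁿ = C([-Δ,0], ℝⁿ)`, equipped with the sup norm. -/
abbrev Hist (Δ : ℝ≥0) (n : ℕ) : Type :=
  ContinuousMap (Icc (-(Δ : ℝ)) (0 : ℝ)) (Vec n)

theorem zero_mem_IccD (Δ : ℝ≥0) : (0 : ℝ) ∈ Icc (-(Δ : ℝ)) (0 : ℝ) :=
  ⟨neg_nonpos.mpr Δ.coe_nonneg, le_refl 0⟩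

/-- `φ(0)`: the current value of a history segment. -/
def ev0 {Δ : ℝ≥0} {n : ℕ} (φ : Hist Δ n) : Vec n :=
  φ ⟨0, zero_mem_IccD Δ⟩

/-! ### Comparison functions -/

/-- Class `𝒦`: continuous, strictly increasing, zero at zero (on `[0,∞)`). -/
def ClassK (α : ℝ → ℝ) : Prop :=
  ContinuousOn α (Ici 0) ∧ StrictMonoOn α (Ici 0) ∧ α 0 = 0

/-- Class `𝒦∞`: class `𝒦` and unbounded. -/
def ClassKinf (α : ℝ → ℝ) : Prop :=
  ClassK α ∧ Tendsto α atTop atTop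

/-- Class `𝒩`: continuous, nondecreasing, zero at zero (on `[0,∞)`). -/
def ClassN (α : ℝ → ℝ) : Prop :=
  ContinuousOn α (Ici 0) ∧ MonotoneOn α (Ici 0) ∧ α 0 = 0

/-- Class `𝒫`: continuous, zero at zero, positive on `(0,∞)`. -/
def ClassP (α : ℝ → ℝ) : Prop :=
  ContinuousOn α (Ici 0) ∧ α 0 = 0 ∧ ∀ s : ℝ, 0 < s → 0 < α s

/-- Class `𝒦ℒ`. -/
def ClassKL (β : ℝ → ℝ → ℝ) : Prop :=
  (∀ t : ℝ, 0 ≤ t → ClassK fun s => β s t) ∧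
    ∀ s : ℝ, 0 ≤ s →
      ContinuousOn (β s) (Ici 0) ∧ AntitoneOn (β s) (Ici 0) ∧
        Tendsto (β s) atTop (𝓝 0)

/-! ### Inputs -/

/-- Admissible input: Lebesgue measurable and locally essentially bounded. -/
def IsInput {m : ℕ} (u : ℝ → Vec m) : Prop :=
  Measurable u ∧ ∀ T : ℝ, 0 < T → ∃ C : ℝ, ∀ᵐ t ∂volume, t ∈ Icc (0 : ℝ) T → ‖u t‖ ≤ C

/-- Essential supremum of `‖u‖` over a set of times. -/
def essBnd {m : ℕ} (u : ℝ → Vec m) (s : Set ℝ) : ℝ :=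
  sInf {C : ℝ | 0 ≤ C ∧ ∀ᵐ τ ∂volume, τ ∈ s → ‖u τ‖ ≤ C}

/-! ### History segments along a trajectory -/

-- The history segment `x_t ∈ 𝒳ⁿ` of a trajectory `x : ℝ → ℝⁿ` (with junk value `0`
-- when `x` is not continuous on `[t-Δ, t]`).
open Classical in
def seg (Δ : ℝ≥0) {n : ℕ} (x : ℝ → Vec n) (t : ℝ) : Hist Δ n :=
  if hx : ContinuousOn x (Icc (t - (Δ : ℝ)) t) then
    { toFun := fun τ => x (t + τ.1)
      continuous_toFun := by
        have h1 : Continuous fun τ : Icc (-(Δ : ℝ)) (0 : ℝ) => t + τ.1 :=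
          continuous_const.add continuous_subtype_val
        have h2 : ∀ τ : Icc (-(Δ : ℝ)) (0 : ℝ), t + τ.1 ∈ Icc (t - (Δ : ℝ)) t := by
          rintro ⟨τ, hτ⟩
          rw [mem_Icc] at hτ ⊢
          constructor
          · linarith [hτ.1]
          · linarith [hτ.2]
        exact hx.comp_continuous h1 h2 }
  else 0

/-! ### Driver's derivative and Dini derivative -/

/-- The deformed history `φ_{h,w}` appearing in Driver's derivative: for `0 ≤ h < Δ`,
`φ_{h,w}(s) = φ(s+h)` for `s ∈ [-Δ,-h)` and `φ_{h,w}(s) = φ(0) + w(h+s)` for `s ∈ [-h,0]`. -/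
def shiftSeg {Δ : ℝ≥0} {n : ℕ} (φ : Hist Δ n) (w : Vec n) (h : ℝ) : Hist Δ n :=
  { toFun := fun s =>
      φ (projIcc (-(Δ : ℝ)) 0 (neg_nonpos.mpr Δ.coe_nonneg) (s.1 + h)) + max (h + s.1) 0 • w
    continuous_toFun := by
      refine Continuous.add ?_ ?_
      · exact φ.continuous.comp (continuous_projIcc.comp
          (continuous_subtype_val.add continuous_const))
      · exact ((continuous_const.add continuous_subtype_val).max continuous_const).smul
          continuous_const }

/-- Driver's derivative `D⁺V(φ,w)`, valued in the extended reals. -/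
def driverD {Δ : ℝ≥0} {n : ℕ} (V : Hist Δ n → ℝ) (φ : Hist Δ n) (w : Vec n) : EReal :=
  limsup (fun h : ℝ => (((V (shiftSeg φ w h) - V φ) / h : ℝ) : EReal)) (𝓝[>] (0 : ℝ))

/-- Upper right-hand Dini derivative of `ν : ℝ → ℝ`, valued in the extended reals. -/
def diniD (ν : ℝ → ℝ) (t : ℝ) : EReal :=
  limsup (fun h : ℝ => (((ν (t + h) - ν t) / h : ℝ) : EReal)) (𝓝[>] (0 : ℝ))

/-! ### Lipschitz conditions -/

/-- `f : 𝒳ⁿ × ℝᵐ → ℝⁿ` is Lipschitz on bounded sets. -/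
def LipOnBounded {Δ : ℝ≥0} {n m : ℕ} (f : Hist Δ n → Vec m → Vec n) : Prop :=
  ∀ r : ℝ, 0 < r → ∃ L : ℝ, 0 < L ∧
    ∀ (φ₁ φ₂ : Hist Δ n) (v₁ v₂ : Vec m),
      ‖φ₁‖ ≤ r → ‖φ₂‖ ≤ r → ‖v₁‖ ≤ r → ‖v₂‖ ≤ r →
        ‖f φ₁ v₁ - f φ₂ v₂‖ ≤ L * (‖φ₁ - φ₂‖ + ‖v₁ - v₂‖)

/-- An input-free vector field `f₀ : 𝒳ⁿ → ℝⁿ` Lipschitz on bounded sets. -/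
def LipOnBounded₀ {Δ : ℝ≥0} {n : ℕ} (f₀ : Hist Δ n → Vec n) : Prop :=
  ∀ r : ℝ, 0 < r → ∃ L : ℝ, 0 < L ∧
    ∀ φ₁ φ₂ : Hist Δ n, ‖φ₁‖ ≤ r → ‖φ₂‖ ≤ r → ‖f₀ φ₁ - f₀ φ₂‖ ≤ L * ‖φ₁ - φ₂‖

/-- A functional `V : 𝒳ⁿ → ℝ` Lipschitz on bounded sets. -/
def LipOnBoundedV {Δ : ℝ≥0} {n : ℕ} (V : Hist Δ n → ℝ) : Prop :=
  ∀ r : ℝ, 0 < r → ∃ L : ℝ, 0 < L ∧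
    ∀ φ₁ φ₂ : Hist Δ n, ‖φ₁‖ ≤ r → ‖φ₂‖ ≤ r → |V φ₁ - V φ₂| ≤ L * ‖φ₁ - φ₂‖

/-- A functional `V : 𝒳ⁿ → ℝ` locally Lipschitz. -/
def LocallyLipV {Δ : ℝ≥0} {n : ℕ} (V : Hist Δ n → ℝ) : Prop :=
  ∀ φ : Hist Δ n, ∃ δ : ℝ, 0 < δ ∧ ∃ L : ℝ, 0 < L ∧
    ∀ φ₁ φ₂ : Hist Δ n, ‖φ₁ - φ‖ ≤ δ → ‖φ₂ - φ‖ ≤ δ → |V φ₁ - V φ₂| ≤ L * ‖φ₁ - φ₂‖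

/-! ### Solutions -/

/-- `x` is a solution of `ẋ(t) = f(x_t, u(t))` with initial state `x₀` on `[0, tmax)`. -/
structure IsSolution (Δ : ℝ≥0) {n m : ℕ} (f : Hist Δ n → Vec m → Vec n)
    (u : ℝ → Vec m) (x₀ : Hist Δ n) (tmax : EReal) (x : ℝ → Vec n) : Prop where
  tmax_pos : 0 < tmax
  cont : ContinuousOn x {s : ℝ | -(Δ : ℝ) ≤ s ∧ (s : EReal) < tmax}
  init : ∀ τ : Icc (-(Δ : ℝ)) (0 : ℝ), x τ.1 = x₀ τ
  integrable : ∀ t : ℝ, 0 ≤ t → (t : EReal) < tmax →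
    IntervalIntegrable (fun s => f (seg Δ x s) (u s)) volume 0 t
  integral_eq : ∀ t : ℝ, 0 ≤ t → (t : EReal) < tmax →
    x t = x 0 + ∫ s in (0:ℝ)..t, f (seg Δ x s) (u s)

/-- Maximal solution: a solution admitting no proper extension. -/
def IsMaxSolution (Δ : ℝ≥0) {n m : ℕ} (f : Hist Δ n → Vec m → Vec n)
    (u : ℝ → Vec m) (x₀ : Hist Δ n) (tmax : EReal) (x : ℝ → Vec n) : Prop :=
  IsSolution Δ f u x₀ tmax x ∧
    ∀ (tmax' : EReal) (x' : ℝ → Vec n), IsSolution Δ f u x₀ tmax' x' →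
      (∀ t : ℝ, -(Δ : ℝ) ≤ t → (t : EReal) < tmax → x' t = x t) → tmax' ≤ tmax

/-- Solution of the input-free system `ẋ(t) = f₀(x_t)`. -/
def IsSolution₀ (Δ : ℝ≥0) {n : ℕ} (f₀ : Hist Δ n → Vec n) (x₀ : Hist Δ n)
    (tmax : EReal) (x : ℝ → Vec n) : Prop :=
  IsSolution Δ (fun φ (_ : Vec 0) => f₀ φ) (fun _ => 0) x₀ tmax x

/-- Maximal solution of the input-free system `ẋ(t) = f₀(x_t)`. -/
def IsMaxSolution₀ (Δ : ℝ≥0) {n : ℕ} (f₀ : Hist Δ n → Vec n) (x₀ : Hist Δ n)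
    (tmax : EReal) (x : ℝ → Vec n) : Prop :=
  IsMaxSolution Δ (fun φ (_ : Vec 0) => f₀ φ) (fun _ => 0) x₀ tmax x

/-! ### Stability properties (input-free systems) -/

/-- Global asymptotic stability (GAS). -/
def GAS (Δ : ℝ≥0) {n : ℕ} (f₀ : Hist Δ n → Vec n) : Prop :=
  ∃ β : ℝ → ℝ → ℝ, ClassKL β ∧
    ∀ (x₀ : Hist Δ n) (tmax : EReal) (x : ℝ → Vec n),
      IsMaxSolution₀ Δ f₀ x₀ tmax x →
        tmax = ⊤ ∧ ∀ t : ℝ, 0 ≤ t → ‖x t‖ ≤ β ‖x₀‖ t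

/-- Global exponential stability (GES). -/
def GES (Δ : ℝ≥0) {n : ℕ} (f₀ : Hist Δ n → Vec n) : Prop :=
  ∃ k : ℝ, 1 ≤ k ∧ ∃ lam : ℝ, 0 < lam ∧
    ∀ (x₀ : Hist Δ n) (tmax : EReal) (x : ℝ → Vec n),
      IsMaxSolution₀ Δ f₀ x₀ tmax x →
        tmax = ⊤ ∧ ∀ t : ℝ, 0 ≤ t → ‖x t‖ ≤ k * ‖x₀‖ * Real.exp (-lam * t)

/-- (Local) asymptotic stability (AS) of the origin. -/
def AS (Δ : ℝ≥0) {n : ℕ} (f₀ : Hist Δ n → Vec n) : Prop :=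
  ∃ r : ℝ, 0 < r ∧ ∃ β : ℝ → ℝ → ℝ, ClassKL β ∧
    ∀ (x₀ : Hist Δ n) (tmax : EReal) (x : ℝ → Vec n),
      IsMaxSolution₀ Δ f₀ x₀ tmax x → ‖x₀‖ ≤ r →
        tmax = ⊤ ∧ ∀ t : ℝ, 0 ≤ t → ‖x t‖ ≤ β ‖x₀‖ t

/-- (Local) exponential stability (ES) of the origin. -/
def ES (Δ : ℝ≥0) {n : ℕ} (f₀ : Hist Δ n → Vec n) : Prop :=
  ∃ r : ℝ, 0 < r ∧ ∃ k : ℝ, 1 ≤ k ∧ ∃ lam : ℝ, 0 < lam ∧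
    ∀ (x₀ : Hist Δ n) (tmax : EReal) (x : ℝ → Vec n),
      IsMaxSolution₀ Δ f₀ x₀ tmax x → ‖x₀‖ ≤ r →
        tmax = ⊤ ∧ ∀ t : ℝ, 0 ≤ t → ‖x t‖ ≤ k * ‖x₀‖ * Real.exp (-lam * t)

/-! ### Forward completeness -/

/-- Robust forward completeness (RFC) of `ẋ(t) = f(x_t,u(t))`. -/
def RFC (Δ : ℝ≥0) {n m : ℕ} (f : Hist Δ n → Vec m → Vec n) : Prop :=
  (∀ (x₀ : Hist Δ n) (u : ℝ → Vec m) (tmax : EReal) (x : ℝ → Vec n),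
      IsInput u → IsMaxSolution Δ f u x₀ tmax x → tmax = ⊤) ∧
    ∀ T : ℝ, 0 < T → ∀ r : ℝ, 0 < r → ∃ C : ℝ,
      ∀ (x₀ : Hist Δ n) (u : ℝ → Vec m) (tmax : EReal) (x : ℝ → Vec n),
        IsInput u → IsMaxSolution Δ f u x₀ tmax x →
          ‖x₀‖ ≤ r → essBnd u (Ici 0) ≤ r →
            ∀ t : ℝ, t ∈ Icc (0 : ℝ) T → ‖seg Δ x t‖ ≤ C

/-- Robust forward completeness of the input-free system `ẋ(t) = f₀(x_t)`. -/
def RFC₀ (Δ : ℝ≥0) {n : ℕ} (f₀ : Hist Δ n → Vec n) : Prop :=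
  RFC Δ (fun φ (_ : Vec 0) => f₀ φ)

/-! ### Input-to-state stability notions -/

/-- Input-to-state stability (ISS). -/
def ISS (Δ : ℝ≥0) {n m : ℕ} (f : Hist Δ n → Vec m → Vec n) : Prop :=
  ∃ β : ℝ → ℝ → ℝ, ∃ μ : ℝ → ℝ, ClassKL β ∧ ClassN μ ∧
    ∀ (x₀ : Hist Δ n) (u : ℝ → Vec m) (tmax : EReal) (x : ℝ → Vec n),
      IsInput u → IsMaxSolution Δ f u x₀ tmax x →
        tmax = ⊤ ∧ ∀ t : ℝ, 0 ≤ t → ‖x t‖ ≤ β ‖x₀‖ t + μ (essBnd u (Icc 0 t))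

/-- Local input-to-state stability (LISS). -/
def LISS (Δ : ℝ≥0) {n m : ℕ} (f : Hist Δ n → Vec m → Vec n) : Prop :=
  ∃ r : ℝ, 0 < r ∧ ∃ β : ℝ → ℝ → ℝ, ∃ μ : ℝ → ℝ, ClassKL β ∧ ClassN μ ∧
    ∀ (x₀ : Hist Δ n) (u : ℝ → Vec m) (tmax : EReal) (x : ℝ → Vec n),
      IsInput u → IsMaxSolution Δ f u x₀ tmax x →
        ‖x₀‖ ≤ r → essBnd u (Ici 0) ≤ r →
          tmax = ⊤ ∧ ∀ t : ℝ, 0 ≤ t → ‖x t‖ ≤ β ‖x₀‖ t + μ (essBnd u (Icc 0 t))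

/-- Integral input-to-state stability (iISS). -/
def iISS (Δ : ℝ≥0) {n m : ℕ} (f : Hist Δ n → Vec m → Vec n) : Prop :=
  ∃ β : ℝ → ℝ → ℝ, ∃ η μ : ℝ → ℝ, ClassKL β ∧ ClassN η ∧ ClassN μ ∧
    ∀ (x₀ : Hist Δ n) (u : ℝ → Vec m) (tmax : EReal) (x : ℝ → Vec n),
      IsInput u → IsMaxSolution Δ f u x₀ tmax x →
        tmax = ⊤ ∧ ∀ t : ℝ, 0 ≤ t →
          ‖x t‖ ≤ β ‖x₀‖ t + η (∫ s in (0:ℝ)..t, μ ‖u s‖)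

/-- The UBEBS estimate with offset `c`. -/
def UBEBSwith (Δ : ℝ≥0) {n m : ℕ} (f : Hist Δ n → Vec m → Vec n) (c : ℝ) : Prop :=
  ∃ α ξ ζ : ℝ → ℝ, ClassKinf α ∧ ClassKinf ξ ∧ ClassKinf ζ ∧
    ∀ (x₀ : Hist Δ n) (u : ℝ → Vec m) (tmax : EReal) (x : ℝ → Vec n),
      IsInput u → IsMaxSolution Δ f u x₀ tmax x →
        tmax = ⊤ ∧ ∀ t : ℝ, 0 ≤ t →
          α ‖x t‖ ≤ ξ ‖x₀‖ + (∫ s in (0:ℝ)..t, ζ ‖u s‖) + c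

/-! ### Lyapunov–Krasovskii functionals -/

/-- Lyapunov–Krasovskii functional candidate (LKF). -/
def IsLKF {Δ : ℝ≥0} {n : ℕ} (V : Hist Δ n → ℝ) : Prop :=
  (∀ φ, 0 ≤ V φ) ∧ LipOnBoundedV V ∧
    ∃ α₁ α₂ : ℝ → ℝ, ClassKinf α₁ ∧ ClassKinf α₂ ∧
      ∀ φ : Hist Δ n, α₁ ‖ev0 φ‖ ≤ V φ ∧ V φ ≤ α₂ ‖φ‖

/-- Coercive Lyapunov–Krasovskii functional candidate. -/
def IsCoerciveLKF {Δ : ℝ≥0} {n : ℕ} (V : Hist Δ n → ℝ) : Prop :=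
  (∀ φ, 0 ≤ V φ) ∧ LipOnBoundedV V ∧
    ∃ α₁ α₂ : ℝ → ℝ, ClassKinf α₁ ∧ ClassKinf α₂ ∧
      ∀ φ : Hist Δ n, α₁ ‖φ‖ ≤ V φ ∧ V φ ≤ α₂ ‖φ‖

end

section HistorySegments

variable {Δ : ℝ≥0} {n : ℕ}

theorem seg_apply {x : ℝ → Vec n} {t : ℝ} (hx : ContinuousOn x (Icc (t - (Δ : ℝ)) t))
    (τ : Icc (-(Δ : ℝ)) (0 : ℝ)) : seg Δ x t τ = x (t + τ.1) := by
  simp [seg, dif_pos hx]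

theorem seg_congr {x y : ℝ → Vec n} {t : ℝ} (h : EqOn x y (Icc (t - (Δ : ℝ)) t)) :
    seg Δ x t = seg Δ y t := by
  by_cases hx : ContinuousOn x (Icc (t - (Δ : ℝ)) t)
  · have hy : ContinuousOn y (Icc (t - (Δ : ℝ)) t) := hx.congr h.symm
    ext1 τ
    rw [seg_apply hx, seg_apply hy]
    apply h
    have := τ.2.1
    have := τ.2.2
    constructor <;> linarith
  · have hy : ¬ContinuousOn y (Icc (t - (Δ : ℝ)) t) := fun hy => hx (hy.congr h)
    simp [seg, dif_neg hx, dif_neg hy]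

theorem continuous_seg {x : ℝ → Vec n} (hx : Continuous x) : Continuous (seg Δ x) := by
  let F : C(ℝ × Icc (-(Δ : ℝ)) (0 : ℝ), Vec n) :=
    ⟨fun q => x (q.1 + q.2.1), by fun_prop⟩
  have h : seg Δ x = F.curry := by
    ext1 t
    ext1 τ
    rw [seg_apply hx.continuousOn]
    rfl
  rw [h]
  exact F.curry.continuous

theorem continuousOn_seg {x : ℝ → Vec n} {a b : ℝ}
    (hx : ContinuousOn x (Icc (a - (Δ : ℝ)) b)) : ContinuousOn (seg Δ x) (Icc a b) := by
  rcases lt_or_ge b a with hab | hab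
  · simp [Icc_eq_empty_of_lt hab]
  have hΔ := Δ.coe_nonneg
  have hle : a - (Δ : ℝ) ≤ b := by linarith
  have hy : Continuous (IccExtend hle ((Icc (a - (Δ : ℝ)) b).domRestrict x)) :=
    (continuousOn_iff_continuous_domRestrict.1 hx).Icc_extend'
  refine (continuous_seg (Δ := Δ) hy).continuousOn.congr fun t ht => seg_congr fun s hs => ?_
  have hs' : s ∈ Icc (a - (Δ : ℝ)) b := ⟨by linarith [ht.1, hs.1], by linarith [ht.2, hs.2]⟩
  rw [IccExtend_of_mem hle _ hs']
  rfl

theorem norm_seg_le {x : ℝ → Vec n} {t r : ℝ} (hr : 0 ≤ r)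
    (hx : ContinuousOn x (Icc (t - (Δ : ℝ)) t))
    (h : ∀ s ∈ Icc (t - (Δ : ℝ)) t, ‖x s‖ ≤ r) : ‖seg Δ x t‖ ≤ r := by
  refine (ContinuousMap.norm_le _ hr).2 fun τ => ?_
  rw [seg_apply hx]
  apply h
  have := τ.2.1
  have := τ.2.2
  constructor <;> linarith

theorem ev0_seg {x : ℝ → Vec n} {t : ℝ} (hx : ContinuousOn x (Icc (t - (Δ : ℝ)) t)) :
    ev0 (seg Δ x t) = x t := by
  rw [ev0, seg_apply hx, add_zero]

theorem norm_ev0_le (φ : Hist Δ n) : ‖ev0 φ‖ ≤ ‖φ‖ := φ.norm_coe_le_norm _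

theorem continuous_of_lipschitz_on_bounded {E F : Type*} [NormedAddCommGroup E]
    [NormedAddCommGroup F] {f : E → F}
    (hf : ∀ r : ℝ, 0 < r → ∃ L : ℝ, 0 < L ∧
      ∀ a b : E, ‖a‖ ≤ r → ‖b‖ ≤ r → ‖f a - f b‖ ≤ L * ‖a - b‖) : Continuous f := by
  rw [continuous_iff_continuousAt]
  intro φ
  obtain ⟨L, -, h⟩ := hf (‖φ‖ + 1) (by positivity)
  have hL : LipschitzOnWith L.toNNReal f (Metric.closedBall 0 (‖φ‖ + 1)) := by
    refine LipschitzOnWith.of_dist_le_mul fun a ha b hb => ?_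
    rw [dist_eq_norm, dist_eq_norm]
    refine (h a b (by simpa using ha) (by simpa using hb)).trans ?_
    gcongr
    exact Real.le_coe_toNNReal L
  refine hL.continuousOn.continuousAt (Filter.mem_of_superset (Metric.ball_mem_nhds φ one_pos) ?_)
  intro ψ hψ
  rw [Metric.mem_ball, dist_eq_norm] at hψ
  rw [mem_closedBall_zero_iff]
  have := norm_le_norm_add_norm_sub' ψ φ
  linarith

theorem LipOnBounded₀.continuous {f : Hist Δ n → Vec n} (hf : LipOnBounded₀ f) :
    Continuous f :=
  continuous_of_lipschitz_on_bounded hf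

theorem LipOnBoundedV.continuous {V : Hist Δ n → ℝ} (hV : LipOnBoundedV V) :
    Continuous V :=
  continuous_of_lipschitz_on_bounded hV

end HistorySegments

section Solutions

variable {Δ : ℝ≥0} {n : ℕ} {f g : Hist Δ n → Vec n} {φ ψ : Hist Δ n} {T T' : EReal}
  {x y : ℝ → Vec n}

theorem IsSolution₀.continuousOn_Icc (hx : IsSolution₀ Δ f φ T x) {a b : ℝ} (ha : -(Δ : ℝ) ≤ a)
    (hb : (b : EReal) < T) : ContinuousOn x (Icc a b) :=
  hx.cont.mono fun _ hs =>
    ⟨ha.trans hs.1, lt_of_le_of_lt (EReal.coe_le_coe_iff.2 hs.2) hb⟩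

theorem IsSolution₀.continuousOn_window (hx : IsSolution₀ Δ f φ T x) {t : ℝ} (ht : 0 ≤ t)
    (hT : (t : EReal) < T) : ContinuousOn x (Icc (t - (Δ : ℝ)) t) :=
  hx.continuousOn_Icc (by linarith) hT

theorem IsSolution₀.continuousOn_seg (hx : IsSolution₀ Δ f φ T x) {b : ℝ}
    (hb : (b : EReal) < T) : ContinuousOn (seg Δ x) (Icc 0 b) :=
  _root_.continuousOn_seg (hx.continuousOn_Icc (by simp) hb)

theorem IsSolution₀.apply_nonpos (hx : IsSolution₀ Δ f φ T x) {s : ℝ}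
    (hs : s ∈ Icc (-(Δ : ℝ)) (0 : ℝ)) : x s = φ ⟨s, hs⟩ :=
  hx.init ⟨s, hs⟩

theorem IsSolution₀.seg_zero (hx : IsSolution₀ Δ f φ T x) : seg Δ x 0 = φ := by
  ext1 τ
  rw [seg_apply (hx.continuousOn_window le_rfl (by simpa using hx.tmax_pos)), zero_add]
  exact hx.init τ

theorem IsSolution₀.eq_add_integral (hx : IsSolution₀ Δ f φ T x) {t : ℝ} (ht : 0 ≤ t)
    (hT : (t : EReal) < T) : x t = x 0 + ∫ s in (0 : ℝ)..t, f (seg Δ x s) :=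
  hx.integral_eq t ht hT

theorem IsSolution₀.intervalIntegrable (hx : IsSolution₀ Δ f φ T x) {t : ℝ} (ht : 0 ≤ t)
    (hT : (t : EReal) < T) : IntervalIntegrable (fun s => f (seg Δ x s)) volume 0 t :=
  hx.integrable t ht hT

theorem isSolution₀_of_continuous (hf : Continuous f) (hT : 0 < T)
    (hc : ContinuousOn x {s : ℝ | -(Δ : ℝ) ≤ s ∧ (s : EReal) < T})
    (hi : ∀ τ : Icc (-(Δ : ℝ)) (0 : ℝ), x τ.1 = φ τ)
    (he : ∀ t : ℝ, 0 ≤ t → (t : EReal) < T →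
      x t = x 0 + ∫ s in (0 : ℝ)..t, f (seg Δ x s)) : IsSolution₀ Δ f φ T x where
  tmax_pos := hT
  cont := hc
  init := hi
  integrable t ht htT := by
    refine ContinuousOn.intervalIntegrable ?_
    rw [uIcc_of_le ht]
    refine hf.comp_continuousOn (_root_.continuousOn_seg (hc.mono fun s hs => ?_))
    rw [zero_sub] at hs
    exact ⟨hs.1, lt_of_le_of_lt (EReal.coe_le_coe_iff.2 hs.2) htT⟩
  integral_eq := he

theorem IsSolution₀.congr_field (hx : IsSolution₀ Δ f φ T x) (hT' : 0 < T') (hle : T' ≤ T)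
    (h : ∀ t : ℝ, 0 ≤ t → (t : EReal) < T' → f (seg Δ x t) = g (seg Δ x t)) :
    IsSolution₀ Δ g φ T' x := by
  have key : ∀ t : ℝ, 0 ≤ t → (t : EReal) < T' →
      EqOn (fun s => f (seg Δ x s)) (fun s => g (seg Δ x s)) (uIcc 0 t) := by
    intro t ht htT s hs
    rw [uIcc_of_le ht] at hs
    exact h s hs.1 (lt_of_le_of_lt (EReal.coe_le_coe_iff.2 hs.2) htT)
  refine ⟨hT', hx.cont.mono fun s hs => ⟨hs.1, hs.2.trans_le hle⟩, hx.init, ?_, ?_⟩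
  · intro t ht htT
    exact (hx.intervalIntegrable ht (htT.trans_le hle)).congr
      ((key t ht htT).mono uIoc_subset_uIcc)
  · intro t ht htT
    rw [hx.eq_add_integral ht (htT.trans_le hle)]
    exact congrArg _ (intervalIntegral.integral_congr (key t ht htT))

theorem IsSolution₀.mono (hx : IsSolution₀ Δ f φ T x) (hT' : 0 < T') (hle : T' ≤ T) :
    IsSolution₀ Δ f φ T' x :=
  hx.congr_field hT' hle fun _ _ _ => rfl

theorem seg_eq_of_eq_of_lt
    (h : ∀ s : ℝ, -(Δ : ℝ) ≤ s → (s : EReal) < T → y s = x s) {t : ℝ} (ht : 0 ≤ t)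
    (htT : (t : EReal) < T) : seg Δ y t = seg Δ x t :=
  seg_congr fun s hs => h s (by linarith [hs.1])
    (lt_of_le_of_lt (EReal.coe_le_coe_iff.2 hs.2) htT)

theorem IsSolution₀.congr (hx : IsSolution₀ Δ f φ T x)
    (h : ∀ s : ℝ, -(Δ : ℝ) ≤ s → (s : EReal) < T → y s = x s) : IsSolution₀ Δ f φ T y := by
  have key : ∀ t : ℝ, 0 ≤ t → (t : EReal) < T →
      EqOn (fun s => f (seg Δ x s)) (fun s => f (seg Δ y s)) (uIcc 0 t) := by
    intro t ht htT s hs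
    rw [uIcc_of_le ht] at hs
    exact congrArg f
      (seg_eq_of_eq_of_lt h hs.1 (lt_of_le_of_lt (EReal.coe_le_coe_iff.2 hs.2) htT)).symm
  have h0 : ((0 : ℝ) : EReal) < T := by simpa using hx.tmax_pos
  refine ⟨hx.tmax_pos, hx.cont.congr fun s hs => h s hs.1 hs.2, fun τ => ?_, ?_, ?_⟩
  · rw [h τ.1 τ.2.1 (lt_of_le_of_lt (EReal.coe_le_coe_iff.2 τ.2.2) h0)]
    exact hx.init τ
  · intro t ht htT
    exact (hx.intervalIntegrable ht htT).congr ((key t ht htT).mono uIoc_subset_uIcc)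
  · intro t ht htT
    have hΔ := Δ.coe_nonneg
    rw [h t (by linarith) htT, h 0 (by linarith) h0, hx.eq_add_integral ht htT]
    exact congrArg _ (intervalIntegral.integral_congr (key t ht htT))

/-- Grönwall's inequality in integral form. -/
theorem le_mul_exp_of_le_add_integral {u : ℝ → ℝ} {δ L b : ℝ} (hL : 0 ≤ L)
    (hu : ContinuousOn u (Icc 0 b))
    (h : ∀ t ∈ Icc 0 b, u t ≤ δ + L * ∫ s in (0 : ℝ)..t, u s) :
    ∀ t ∈ Icc 0 b, u t ≤ δ * Real.exp (L * t) := by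
  intro t ht
  have hb : 0 ≤ b := ht.1.trans ht.2
  let v : ℝ → ℝ := IccExtend hb ((Icc 0 b).domRestrict u)
  have hv : Continuous v := (continuousOn_iff_continuous_domRestrict.1 hu).Icc_extend'
  have huv : ∀ s ∈ Icc 0 b, v s = u s := fun s hs => IccExtend_of_mem hb _ hs
  have hprim : ∀ s ∈ Icc 0 b, ∫ r in (0 : ℝ)..s, u r = ∫ r in (0 : ℝ)..s, v r := by
    intro s hs
    refine intervalIntegral.integral_congr fun r hr => ?_
    rw [uIcc_of_le hs.1] at hr
    exact (huv r ⟨hr.1, hr.2.trans hs.2⟩).symm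
  let G : ℝ → ℝ := fun s => δ + L * ∫ r in (0 : ℝ)..s, v r
  have hG : ∀ s, HasDerivAt G (L * v s) s := fun s =>
    ((hv.integral_hasStrictDerivAt 0 s).hasDerivAt.const_mul L).const_add δ
  have hle : ∀ s ∈ Icc 0 b, v s ≤ G s := fun s hs => by
    rw [huv s hs]
    simpa only [G, hprim s hs] using h s hs
  have key := le_gronwallBound_of_liminf_deriv_right_le (f := G) (f' := fun s => L * v s)
    (δ := δ) (K := L) (ε := 0) (a := 0) (b := b)
    (fun s _ => (hG s).continuousAt.continuousWithinAt)
    (fun s _ r hr => (hG s).hasDerivWithinAt.liminf_right_slope_le hr)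
    (by simp [G])
    (fun s hs => by simpa using mul_le_mul_of_nonneg_left (hle s ⟨hs.1, hs.2.le⟩) hL) t ht
  rw [gronwallBound_ε0, sub_zero] at key
  rw [← huv t ht]
  exact (hle t ht).trans key

theorem IsSolution₀.norm_seg_sub_le (hx : IsSolution₀ Δ f φ T x) (hy : IsSolution₀ Δ f ψ T y)
    {r L b : ℝ} (hL : 0 ≤ L)
    (hf : ∀ φ₁ φ₂ : Hist Δ n, ‖φ₁‖ ≤ r → ‖φ₂‖ ≤ r → ‖f φ₁ - f φ₂‖ ≤ L * ‖φ₁ - φ₂‖)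
    (hb : (b : EReal) < T) (hxr : ∀ t ∈ Icc 0 b, ‖seg Δ x t‖ ≤ r)
    (hyr : ∀ t ∈ Icc 0 b, ‖seg Δ y t‖ ≤ r) :
    ∀ t ∈ Icc 0 b, ‖seg Δ x t - seg Δ y t‖ ≤ ‖φ - ψ‖ * Real.exp (L * t) := by
  have hu : ContinuousOn (fun t => ‖seg Δ x t - seg Δ y t‖) (Icc 0 b) :=
    ((hx.continuousOn_seg hb).sub (hy.continuousOn_seg hb)).norm
  have hlt : ∀ {t : ℝ}, t ≤ b → (t : EReal) < T := fun h =>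
    lt_of_le_of_lt (EReal.coe_le_coe_iff.2 h) hb
  have hui : ∀ {s : ℝ}, s ∈ Icc 0 b →
      IntervalIntegrable (fun t => ‖seg Δ x t - seg Δ y t‖) volume 0 s := fun {s} hs => by
    refine ContinuousOn.intervalIntegrable ?_
    rw [uIcc_of_le hs.1]
    exact hu.mono (Icc_subset_Icc_right hs.2)
  refine le_mul_exp_of_le_add_integral hL hu fun t ht => ?_
  have hnn : 0 ≤ ∫ s in (0 : ℝ)..t, ‖seg Δ x s - seg Δ y s‖ :=
    intervalIntegral.integral_nonneg ht.1 fun _ _ => norm_nonneg _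
  have hpt : ∀ s ∈ Icc (-(Δ : ℝ)) 0, ‖x s - y s‖ ≤ ‖φ - ψ‖ := fun s hs => by
    rw [hx.apply_nonpos hs, hy.apply_nonpos hs]
    exact (φ - ψ).norm_coe_le_norm ⟨s, hs⟩
  refine (ContinuousMap.norm_le _ (by positivity)).2 fun τ => ?_
  rw [ContinuousMap.sub_apply, seg_apply (hx.continuousOn_window ht.1 (hlt ht.2)),
    seg_apply (hy.continuousOn_window ht.1 (hlt ht.2))]
  have h1 := τ.2.1
  have h2 := τ.2.2
  rcases le_or_gt (t + τ.1) 0 with hs | hs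
  · refine (hpt _ ⟨by linarith [ht.1], hs⟩).trans ?_
    nlinarith [mul_nonneg hL hnn]
  · generalize hst : t + τ.1 = s at hs
    have hs' : s ∈ Icc 0 b := ⟨hs.le, by linarith [ht.2]⟩
    have hsT := hlt hs'.2
    rw [hx.eq_add_integral hs.le hsT, hy.eq_add_integral hs.le hsT, add_sub_add_comm,
      ← intervalIntegral.integral_sub (hx.intervalIntegrable hs.le hsT)
        (hy.intervalIntegrable hs.le hsT)]
    refine (norm_add_le _ _).trans (add_le_add (hpt 0 ⟨by simp, le_rfl⟩) ?_)
    calc _ ≤ ∫ r in (0 : ℝ)..s, L * ‖seg Δ x r - seg Δ y r‖ := by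
          refine intervalIntegral.norm_integral_le_of_norm_le hs.le ?_ ((hui hs').const_mul L)
          refine Filter.Eventually.of_forall fun r hr => ?_
          have hr' : r ∈ Icc 0 b := ⟨hr.1.le, hr.2.trans hs'.2⟩
          exact hf _ _ (hxr r hr') (hyr r hr')
      _ = L * ∫ r in (0 : ℝ)..s, ‖seg Δ x r - seg Δ y r‖ :=
          intervalIntegral.integral_const_mul _ _
      _ ≤ _ := by
          refine mul_le_mul_of_nonneg_left ?_ hL
          exact intervalIntegral.integral_mono_interval le_rfl hs.le (by linarith)
            (Filter.Eventually.of_forall fun _ => norm_nonneg _) (hui ht)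

theorem IsSolution₀.exists_norm_seg_le (hx : IsSolution₀ Δ f φ T x) {b : ℝ}
    (hb : (b : EReal) < T) : ∃ r : ℝ, ∀ t ∈ Icc 0 b, ‖seg Δ x t‖ ≤ r :=
  isCompact_Icc.exists_bound_of_continuousOn (hx.continuousOn_seg hb)

theorem IsSolution₀.eq (hf : LipOnBounded₀ f) (hx : IsSolution₀ Δ f φ T x)
    (hy : IsSolution₀ Δ f φ T y) {t : ℝ} (ht : -(Δ : ℝ) ≤ t) (htT : (t : EReal) < T) :
    x t = y t := by
  rcases le_or_gt t 0 with ht0 | ht0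
  · rw [hx.apply_nonpos ⟨ht, ht0⟩, hy.apply_nonpos ⟨ht, ht0⟩]
  obtain ⟨r₁, h₁⟩ := hx.exists_norm_seg_le htT
  obtain ⟨r₂, h₂⟩ := hy.exists_norm_seg_le htT
  obtain ⟨L, hL, hfL⟩ := hf (max 1 (max r₁ r₂)) (by positivity)
  have key := hx.norm_seg_sub_le hy hL.le hfL htT
    (fun s hs => (h₁ s hs).trans (by simp)) (fun s hs => (h₂ s hs).trans (by simp)) t
    ⟨ht0.le, le_rfl⟩
  rw [sub_self, norm_zero, zero_mul] at key
  have h := sub_eq_zero.1 (norm_le_zero_iff.1 key)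
  rw [← ev0_seg (hx.continuousOn_window ht0.le htT), h,
    ev0_seg (hy.continuousOn_window ht0.le htT)]

theorem exists_isSolution₀_top {L M : ℝ} (hL : 0 < L)
    (hf : ∀ φ₁ φ₂ : Hist Δ n, ‖f φ₁ - f φ₂‖ ≤ L * ‖φ₁ - φ₂‖) (hM : ∀ φ, ‖f φ‖ ≤ M)
    (φ : Hist Δ n) : ∃ x : ℝ → Vec n, Continuous x ∧ IsSolution₀ Δ f φ ⊤ x := by
  have hfc : Continuous f := LipOnBounded₀.continuous fun _ _ => ⟨L, hL, fun _ _ _ _ => hf _ _⟩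
  have hM0 : 0 ≤ M := (norm_nonneg _).trans (hM 0)
  set c : ℝ := 2 * L with hc
  have hc0 : 0 < c := by positivity
  have hΔ : -(Δ : ℝ) ≤ 0 := neg_nonpos.mpr Δ.coe_nonneg
  let X : BoundedContinuousFunction ℝ (Vec n) → ℝ → Vec n := fun u s =>
    φ (projIcc (-(Δ : ℝ)) 0 hΔ s) + Real.exp (c * max s 0) • u (max s 0)
  have hX : ∀ u, Continuous (X u) := fun u =>
    (φ.continuous.comp continuous_projIcc).add
      (Continuous.smul (by fun_prop : Continuous fun s : ℝ => Real.exp (c * max s 0))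
        (u.continuous.comp (by fun_prop : Continuous fun s : ℝ => max s 0)))
  have hF : ∀ u, Continuous fun s => f (seg Δ (X u) s) := fun u =>
    hfc.comp (continuous_seg (hX u))
  let J : BoundedContinuousFunction ℝ (Vec n) → ℝ → Vec n := fun u t =>
    Real.exp (-(c * max t 0)) • ∫ s in (0 : ℝ)..max t 0, f (seg Δ (X u) s)
  have hJc : ∀ u, Continuous (J u) := fun u => by
    refine Continuous.smul (by fun_prop : Continuous fun t : ℝ => Real.exp (-(c * max t 0))) ?_
    exact (intervalIntegral.continuous_primitive
      (fun a b => (hF u).intervalIntegrable a b) 0).comp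
        (by fun_prop : Continuous fun t : ℝ => max t 0)
  have hJb : ∀ u t, ‖J u t‖ ≤ M / c := fun u t => by
    have ht : 0 ≤ max t 0 := le_max_right _ _
    simp only [J, norm_smul, Real.norm_eq_abs, Real.abs_exp]
    generalize max t 0 = s at ht ⊢
    have h1 : ‖∫ r in (0 : ℝ)..s, f (seg Δ (X u) r)‖ ≤ M * s := by
      simpa [abs_of_nonneg ht] using
        intervalIntegral.norm_integral_le_of_norm_le_const (a := 0) (b := s)
          (fun r _ => hM (seg Δ (X u) r))
    have h2 : c * s * Real.exp (-(c * s)) ≤ 1 := by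
      rw [Real.exp_neg, ← div_eq_mul_inv, div_le_one (Real.exp_pos _)]
      linarith [Real.add_one_le_exp (c * s)]
    rw [le_div_iff₀ hc0]
    calc _ ≤ Real.exp (-(c * s)) * (M * s) * c := by gcongr
      _ = M * (c * s * Real.exp (-(c * s))) := by ring
      _ ≤ M := mul_le_of_le_one_right hM0 h2
  let Φ : BoundedContinuousFunction ℝ (Vec n) → BoundedContinuousFunction ℝ (Vec n) := fun u =>
    BoundedContinuousFunction.ofNormedAddCommGroup (J u) (hJc u) (M / c) (hJb u)
  have hseg : ∀ u v s, 0 ≤ s →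
      ‖seg Δ (X u) s - seg Δ (X v) s‖ ≤ Real.exp (c * s) * ‖u - v‖ := fun u v s hs => by
    refine (ContinuousMap.norm_le _ (by positivity)).2 fun τ => ?_
    rw [ContinuousMap.sub_apply, seg_apply (hX u).continuousOn, seg_apply (hX v).continuousOn]
    simp only [X, add_sub_add_left_eq_sub, ← smul_sub, norm_smul, Real.norm_eq_abs, Real.abs_exp]
    gcongr
    · have := τ.2.2
      exact max_le (by linarith) hs
    · exact (u - v).norm_coe_le_norm _
  have hΦ : ContractingWith (1 / 2) Φ := by
    refine ⟨by norm_num, LipschitzWith.of_dist_le_mul fun u v => ?_⟩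
    rw [dist_eq_norm, dist_eq_norm]
    refine (BoundedContinuousFunction.norm_le (by positivity)).2 fun t => ?_
    change ‖J u t - J v t‖ ≤ _
    have ht : 0 ≤ max t 0 := le_max_right _ _
    simp only [J, ← smul_sub]
    generalize max t 0 = s at ht ⊢
    rw [← intervalIntegral.integral_sub ((hF u).intervalIntegrable _ _)
      ((hF v).intervalIntegrable _ _), norm_smul, Real.norm_eq_abs, Real.abs_exp]
    have h1 : ‖∫ r in (0 : ℝ)..s, (f (seg Δ (X u) r) - f (seg Δ (X v) r))‖ ≤
        ∫ r in (0 : ℝ)..s, L * ‖u - v‖ * Real.exp (c * r) := by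
      refine intervalIntegral.norm_integral_le_of_norm_le ht ?_
        (Continuous.intervalIntegrable (by fun_prop) _ _)
      refine Filter.Eventually.of_forall fun r hr => (hf _ _).trans ?_
      rw [mul_assoc, mul_comm ‖u - v‖]
      exact mul_le_mul_of_nonneg_left (hseg u v r hr.1.le) hL.le
    have h2 : ∫ r in (0 : ℝ)..s, L * ‖u - v‖ * Real.exp (c * r) =
        L * ‖u - v‖ * (c⁻¹ * (Real.exp (c * s) - 1)) := by
      rw [intervalIntegral.integral_const_mul, intervalIntegral.integral_comp_mul_left _ hc0.ne',
        integral_exp]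
      simp
    rw [h2] at h1
    have h3 : Real.exp (-(c * s)) * (Real.exp (c * s) - 1) ≤ 1 := by
      rw [mul_sub, ← Real.exp_add, neg_add_cancel, Real.exp_zero]
      linarith [Real.exp_pos (-(c * s))]
    calc _ ≤ Real.exp (-(c * s)) * (L * ‖u - v‖ * (c⁻¹ * (Real.exp (c * s) - 1))) := by gcongr
      _ = L * c⁻¹ * ‖u - v‖ * (Real.exp (-(c * s)) * (Real.exp (c * s) - 1)) := by ring
      _ ≤ L * c⁻¹ * ‖u - v‖ := mul_le_of_le_one_right (by positivity) h3
      _ = _ := by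
        rw [hc]
        push_cast
        field_simp
  let u := hΦ.fixedPoint
  have hu : ∀ t, u t = J u t := fun t =>
    (congrArg (fun v : BoundedContinuousFunction ℝ (Vec n) => v t) hΦ.fixedPoint_isFixedPt).symm
  have hpos : ∀ t, 0 ≤ t → X u t =
      φ ⟨0, zero_mem_IccD Δ⟩ + ∫ s in (0 : ℝ)..t, f (seg Δ (X u) s) := fun t ht => by
    conv_lhs => simp only [X]
    rw [projIcc_of_right_le _ ht, hu]
    simp only [J, max_eq_left ht, smul_smul, ← Real.exp_add, add_neg_cancel, Real.exp_zero,
      one_smul]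
  have hneg : ∀ τ : Icc (-(Δ : ℝ)) (0 : ℝ), X u τ.1 = φ τ := fun τ => by
    simp only [X]
    rw [hu]
    simp [J, max_eq_right τ.2.2]
  refine ⟨X u, hX u, isSolution₀_of_continuous hfc (by simp) (hX u).continuousOn hneg ?_⟩
  intro t ht _
  rw [hpos t ht, hneg ⟨0, zero_mem_IccD Δ⟩]

theorem LipOnBounded₀.exists_globalization (hf : LipOnBounded₀ f) (hf0 : f 0 = 0) {R : ℝ}
    (hR : 0 < R) : ∃ g : Hist Δ n → Vec n, ∃ L M : ℝ, 0 < L ∧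
      (∀ φ₁ φ₂ : Hist Δ n, ‖g φ₁ - g φ₂‖ ≤ L * ‖φ₁ - φ₂‖) ∧ (∀ φ, ‖g φ‖ ≤ M) ∧
      ∀ φ, ‖φ‖ ≤ R → f φ = g φ := by
  obtain ⟨L, hL, hfL⟩ := hf (R + 1) (by linarith)
  let χ : Hist Δ n → ℝ := fun φ => max 0 (min 1 (R + 1 - ‖φ‖))
  have hχ0 : ∀ φ, 0 ≤ χ φ := fun φ => le_max_left _ _
  have hχ1 : ∀ φ, χ φ ≤ 1 := fun φ => max_le zero_le_one (min_le_left _ _)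
  have hχ : ∀ φ₁ φ₂, |χ φ₁ - χ φ₂| ≤ ‖φ₁ - φ₂‖ := fun φ₁ φ₂ => by
    have h1 := abs_max_sub_max_le_max 0 (min 1 (R + 1 - ‖φ₁‖)) 0 (min 1 (R + 1 - ‖φ₂‖))
    have h2 := abs_min_sub_min_le_max 1 (R + 1 - ‖φ₁‖) 1 (R + 1 - ‖φ₂‖)
    have h3 := abs_norm_sub_norm_le φ₂ φ₁
    rw [norm_sub_rev] at h3
    have h4 : R + 1 - ‖φ₁‖ - (R + 1 - ‖φ₂‖) = ‖φ₂‖ - ‖φ₁‖ := by ring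
    rw [sub_self, abs_zero, max_eq_right (abs_nonneg (_ : ℝ))] at h1 h2
    rw [h4] at h2
    exact h1.trans (h2.trans h3)
  have hχout : ∀ φ, R + 1 ≤ ‖φ‖ → χ φ = 0 := fun φ h =>
    max_eq_left ((min_le_right _ _).trans (by linarith))
  have hfb : ∀ φ : Hist Δ n, ‖φ‖ ≤ R + 1 → ‖f φ‖ ≤ L * (R + 1) := fun φ h => by
    have := hfL φ 0 h (by simpa using by linarith)
    rw [hf0, sub_zero, sub_zero] at this
    exact this.trans (by gcongr)
  have hM : 0 < L * (R + 1) := by positivity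
  have hin : ∀ φ₁ φ₂ : Hist Δ n, ‖φ₁‖ ≤ R + 1 →
      ‖χ φ₁ • f φ₁ - χ φ₂ • f φ₂‖ ≤ (L * (R + 1) + L) * ‖φ₁ - φ₂‖ := fun φ₁ φ₂ h₁ => by
    have hA : ‖(χ φ₁ - χ φ₂) • f φ₁‖ ≤ L * (R + 1) * ‖φ₁ - φ₂‖ := by
      rw [norm_smul, Real.norm_eq_abs, mul_comm]
      exact mul_le_mul (hfb _ h₁) (hχ _ _) (abs_nonneg _) hM.le
    have hB : ‖χ φ₂ • (f φ₁ - f φ₂)‖ ≤ L * ‖φ₁ - φ₂‖ := by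
      rcases le_total (R + 1) ‖φ₂‖ with h | h
      · rw [hχout _ h, zero_smul, norm_zero]
        positivity
      · rw [norm_smul, Real.norm_of_nonneg (hχ0 _)]
        exact (mul_le_of_le_one_left (norm_nonneg _) (hχ1 _)).trans (hfL _ _ h₁ h)
    have hAB : χ φ₁ • f φ₁ - χ φ₂ • f φ₂ = (χ φ₁ - χ φ₂) • f φ₁ + χ φ₂ • (f φ₁ - f φ₂) := by
      module
    rw [hAB, add_mul]
    exact (norm_add_le _ _).trans (add_le_add hA hB)
  refine ⟨fun φ => χ φ • f φ, L * (R + 1) + L, L * (R + 1), by positivity, fun φ₁ φ₂ => ?_,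
    fun φ => ?_, fun φ h => ?_⟩
  · rcases le_total ‖φ₁‖ (R + 1) with h₁ | h₁
    · exact hin φ₁ φ₂ h₁
    · rcases le_total ‖φ₂‖ (R + 1) with h₂ | h₂
      · rw [norm_sub_rev, norm_sub_rev φ₁]
        exact hin φ₂ φ₁ h₂
      · simp only [hχout _ h₁, hχout _ h₂, zero_smul, sub_self, norm_zero]
        positivity
  · rcases le_total ‖φ‖ (R + 1) with h | h
    · rw [norm_smul, Real.norm_of_nonneg (hχ0 _)]
      exact (mul_le_of_le_one_left (norm_nonneg _) (hχ1 _)).trans (hfb _ h)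
    · simp only [hχout _ h, zero_smul, norm_zero]
      exact hM.le
  · have : χ φ = 1 := by
      simp only [χ]
      rw [min_eq_left (by linarith), max_eq_right zero_le_one]
    simp only [this, one_smul]

theorem exists_isSolution₀ (hf : LipOnBounded₀ f) (hf0 : f 0 = 0) (φ : Hist Δ n) :
    ∃ (T : EReal) (x : ℝ → Vec n), IsSolution₀ Δ f φ T x := by
  obtain ⟨g, L, M, hL, hgL, hgM, hfg⟩ :=
    hf.exists_globalization hf0 (R := ‖φ‖ + 1) (by positivity)
  obtain ⟨y, hyc, hy⟩ := exists_isSolution₀_top hL hgL hgM φ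
  have hev : ∀ᶠ t in 𝓝 (0 : ℝ), ‖seg Δ y t‖ < ‖φ‖ + 1 := by
    refine (continuous_seg hyc).norm.continuousAt.eventually_lt continuousAt_const ?_
    rw [hy.seg_zero]
    linarith
  obtain ⟨δ, hδ, h⟩ := Metric.eventually_nhds_iff.1 hev
  refine ⟨δ, y, hy.congr_field (by exact_mod_cast hδ) le_top fun t ht htT => ?_⟩
  refine (hfg _ (h ?_).le).symm
  rw [Real.dist_eq, sub_zero, abs_of_nonneg ht]
  exact_mod_cast htT

theorem exists_isMaxSolution₀ (hf : LipOnBounded₀ f) (hf0 : f 0 = 0) (φ : Hist Δ n) :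
    ∃ (T : EReal) (x : ℝ → Vec n), IsMaxSolution₀ Δ f φ T x := by
  classical
  let S : Set EReal := {T | ∃ x, IsSolution₀ Δ f φ T x}
  choose X hX using fun T : S => T.2
  let x : ℝ → Vec n := fun t =>
    if h : ∃ T : S, (t : EReal) < T.1 then X h.choose t else 0
  have hx : ∀ (T : S) (t : ℝ), -(Δ : ℝ) ≤ t → (t : EReal) < T.1 → x t = X T t := by
    intro T t ht htT
    have h : ∃ T : S, (t : EReal) < T.1 := ⟨T, htT⟩
    simp only [x, dif_pos h]
    have hpos : 0 < min h.choose.1 T.1 := lt_min (hX _).tmax_pos (hX _).tmax_pos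
    exact ((hX _).mono hpos (min_le_left _ _)).eq hf ((hX T).mono hpos (min_le_right _ _)) ht
      (lt_min h.choose_spec htT)
  have hxs : ∀ T : S, IsSolution₀ Δ f φ T.1 x := fun T => (hX T).congr (hx T)
  obtain ⟨T₀, x₀, h₀⟩ := exists_isSolution₀ hf hf0 φ
  have hlt : ∀ {t : ℝ}, (t : EReal) < sSup S → ∃ T : S, (t : EReal) < T.1 := fun h => by
    obtain ⟨T, hT, htT⟩ := lt_sSup_iff.1 h
    exact ⟨⟨T, hT⟩, htT⟩
  refine ⟨sSup S, x, isSolution₀_of_continuous hf.continuous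
    (h₀.tmax_pos.trans_le (le_sSup ⟨x₀, h₀⟩)) ?_ (hxs ⟨T₀, x₀, h₀⟩).init ?_, ?_⟩
  · rintro s ⟨hs, hsT⟩
    obtain ⟨T, hT⟩ := hlt hsT
    refine ((hxs T).cont s ⟨hs, hT⟩).mono_of_mem_nhdsWithin ?_
    have : {r : ℝ | (r : EReal) < T.1} ∈ 𝓝 s :=
      (isOpen_Iio.preimage continuous_coe_real_ereal).mem_nhds hT
    filter_upwards [self_mem_nhdsWithin, mem_nhdsWithin_of_mem_nhds this] with r h₁ h₂
    exact ⟨h₁.1, h₂⟩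
  · intro t ht htT
    obtain ⟨T, hT⟩ := hlt htT
    exact (hxs T).eq_add_integral ht hT
  · intro T' x' hx' _
    exact le_sSup ⟨x', hx'⟩

theorem IsSolution₀.norm_seg_le (hx : IsSolution₀ Δ f φ T x) {R : ℝ}
    (hR : ∀ t : ℝ, 0 ≤ t → (t : EReal) < T → ‖x t‖ ≤ R) {t : ℝ} (ht : 0 ≤ t)
    (htT : (t : EReal) < T) : ‖seg Δ x t‖ ≤ max ‖φ‖ R := by
  refine _root_.norm_seg_le (by positivity) (hx.continuousOn_window ht htT) fun s hs => ?_
  rcases le_total s 0 with h | h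
  · rw [hx.apply_nonpos ⟨by linarith [hs.1], h⟩]
    exact (φ.norm_coe_le_norm _).trans (le_max_left _ _)
  · exact (hR s h (lt_of_le_of_lt (EReal.coe_le_coe_iff.2 hs.2) htT)).trans (le_max_right _ _)

theorem IsMaxSolution₀.eq_top_of_bounded (hf : LipOnBounded₀ f) (hf0 : f 0 = 0)
    (hx : IsMaxSolution₀ Δ f φ T x) {R : ℝ}
    (hR : ∀ t : ℝ, 0 ≤ t → (t : EReal) < T → ‖x t‖ ≤ R) : T = ⊤ := by
  by_contra hT
  have hxs : IsSolution₀ Δ f φ T x := hx.1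
  have hpos := hxs.tmax_pos
  lift T to ℝ using ⟨hT, (bot_le.trans_lt hpos).ne'⟩
  set B := max ‖φ‖ R with hB
  have hB0 : 0 ≤ B := (norm_nonneg φ).trans (le_max_left _ _)
  obtain ⟨g, L, M, hL, hgL, hgM, hfg⟩ := hf.exists_globalization hf0 (R := B + 1) (by linarith)
  obtain ⟨y, hyc, hy⟩ := exists_isSolution₀_top hL hgL hgM φ
  have hseg : ∀ t : ℝ, 0 ≤ t → t < T → ‖seg Δ x t‖ ≤ B := fun t ht htT =>
    hxs.norm_seg_le hR ht (by exact_mod_cast htT)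
  have hxg : IsSolution₀ Δ g φ T x := hxs.congr_field hpos le_rfl fun t ht htT =>
    hfg _ ((hseg t ht (by exact_mod_cast htT)).trans (by linarith))
  have hyx : ∀ s : ℝ, -(Δ : ℝ) ≤ s → (s : EReal) < T → y s = x s := fun s hs hsT =>
    (hy.mono hpos le_top).eq (fun _ _ => ⟨L, hL, fun _ _ _ _ => hgL _ _⟩) hxg hs hsT
  have hT0 : 0 < T := by exact_mod_cast hpos
  have hys : ∀ t : ℝ, 0 ≤ t → t < T → ‖seg Δ y t‖ ≤ B := fun t ht htT => by
    rw [seg_eq_of_eq_of_lt hyx ht (by exact_mod_cast htT)]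
    exact hseg t ht htT
  have hyT : ‖seg Δ y T‖ ≤ B := by
    refine le_of_tendsto (((continuous_seg hyc).norm.tendsto T).mono_left
      (nhdsWithin_le_nhds (s := Iio T))) ?_
    filter_upwards [Ico_mem_nhdsLT hT0] with t ht using hys t ht.1 ht.2
  have hev : ∀ᶠ t in 𝓝 T, ‖seg Δ y t‖ < B + 1 :=
    (continuous_seg hyc).norm.continuousAt.eventually_lt continuousAt_const (by linarith)
  obtain ⟨δ, hδ, h⟩ := Metric.eventually_nhds_iff.1 hev
  have hyf : IsSolution₀ Δ f φ ((T + δ : ℝ) : EReal) y := by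
    refine hy.congr_field (by exact_mod_cast (by linarith)) le_top fun t ht htT => ?_
    refine (hfg _ ?_).symm
    rcases lt_or_ge t T with h' | h'
    · linarith [hys t ht h']
    · refine (h ?_).le
      rw [Real.dist_eq, abs_of_nonneg (by linarith)]
      have : t < T + δ := by exact_mod_cast htT
      linarith
  have := hx.2 _ y hyf hyx
  have : T + δ ≤ T := by exact_mod_cast this
  linarith

theorem IsSolution₀.shift (hf : LipOnBounded₀ f) (hx : IsSolution₀ Δ f φ ⊤ x) {h : ℝ}
    (hh : 0 ≤ h) : IsSolution₀ Δ f (seg Δ x h) ⊤ fun t => x (t + h) := by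
  have hc : ∀ {a b : ℝ}, -(Δ : ℝ) ≤ a → ContinuousOn x (Icc a b) := fun ha =>
    hx.continuousOn_Icc ha (EReal.coe_lt_top _)
  have hseg : ∀ t, 0 ≤ t → seg Δ (fun t => x (t + h)) t = seg Δ x (t + h) := fun t ht => by
    have hw : ContinuousOn (fun t => x (t + h)) (Icc (t - (Δ : ℝ)) t) := by
      refine (hc (a := t + h - Δ) (b := t + h) (by linarith)).comp (by fun_prop) fun s hs => ?_
      exact ⟨by linarith [hs.1], by linarith [hs.2]⟩
    ext1 τ
    rw [seg_apply hw, seg_apply (hc (by linarith)), add_right_comm]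
  refine isSolution₀_of_continuous hf.continuous (by simp) ?_ ?_ ?_
  · refine hx.cont.comp (by fun_prop) fun s hs => ?_
    exact ⟨by linarith [hs.1], EReal.coe_lt_top _⟩
  · intro τ
    rw [seg_apply (hc (by linarith)), add_comm]
  · intro t ht _
    have h1 : ∫ s in (0 : ℝ)..t, f (seg Δ (fun t => x (t + h)) s) =
        ∫ s in h..t + h, f (seg Δ x s) := by
      have h2 := intervalIntegral.integral_comp_add_right (a := 0) (b := t)
        (fun s => f (seg Δ x s)) h
      rw [zero_add] at h2
      rw [← h2]
      refine intervalIntegral.integral_congr fun s hs => ?_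
      rw [uIcc_of_le ht] at hs
      exact congrArg f (hseg s hs.1)
    rw [h1, hx.eq_add_integral (add_nonneg ht hh) (EReal.coe_lt_top _), zero_add,
      hx.eq_add_integral hh (EReal.coe_lt_top _), add_assoc,
      intervalIntegral.integral_add_adjacent_intervals
        (hx.intervalIntegrable hh (EReal.coe_lt_top _))]
    exact (hx.intervalIntegrable hh (EReal.coe_lt_top _)).symm.trans
      (hx.intervalIntegrable (add_nonneg ht hh) (EReal.coe_lt_top _))

/-- Along a solution, the state `x_{t+h}` agrees up to `o(h)` with the state `x_t` deformed in the
direction `f (x_t)`. -/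
theorem IsSolution₀.eventually_norm_seg_sub_shiftSeg_le (hf : LipOnBounded₀ f)
    (hx : IsSolution₀ Δ f φ T x) {t : ℝ} (ht : 0 ≤ t) (htT : (t : EReal) < T) {ε : ℝ}
    (hε : 0 < ε) : ∀ᶠ h in 𝓝[>] (0 : ℝ),
      ‖seg Δ x (t + h) - shiftSeg (seg Δ x t) (f (seg Δ x t)) h‖ ≤ ε * h := by
  obtain ⟨b, htb, hbT⟩ := EReal.lt_iff_exists_real_btwn.1 htT
  have htb' : t < b := by exact_mod_cast htb
  have hFc : ContinuousOn (fun s => f (seg Δ x s)) (Icc 0 b) :=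
    hf.continuous.comp_continuousOn (hx.continuousOn_seg hbT)
  have hev : ∀ᶠ s in 𝓝[Icc 0 b] t, ‖f (seg Δ x s) - f (seg Δ x t)‖ < ε := by
    have := ((hFc t ⟨ht, htb'.le⟩).sub continuousWithinAt_const).norm
      (f := fun s => f (seg Δ x s) - f (seg Δ x t))
    exact this.eventually_lt continuousWithinAt_const (by simpa using hε)
  obtain ⟨δ, hδ, hδε⟩ := Metric.mem_nhdsWithin_iff.1 hev
  filter_upwards [Ioo_mem_nhdsGT (lt_min hδ (sub_pos.2 htb'))] with h hh
  have hh0 : 0 < h := hh.1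
  have hhδ : h < δ := hh.2.trans_le (min_le_left _ _)
  have hhb : t + h < b := by linarith [hh.2.trans_le (min_le_right _ _)]
  have hlt : ∀ {s : ℝ}, s ≤ b → (s : EReal) < T := fun h =>
    lt_of_le_of_lt (EReal.coe_le_coe_iff.2 h) hbT
  refine (ContinuousMap.norm_le _ (by positivity)).2 fun τ => ?_
  have h1 := τ.2.1
  have h2 := τ.2.2
  rw [ContinuousMap.sub_apply, seg_apply (hx.continuousOn_window (by linarith) (hlt hhb.le))]
  change ‖x (t + h + τ.1) - (seg Δ x t (projIcc _ _ _ (τ.1 + h)) +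
    max (h + τ.1) 0 • f (seg Δ x t))‖ ≤ _
  rw [seg_apply (hx.continuousOn_window ht htT)]
  rcases le_or_gt (h + τ.1) 0 with hs | hs
  · rw [max_eq_right hs, zero_smul, add_zero,
      projIcc_of_mem _ (⟨by linarith, by linarith⟩ : τ.1 + h ∈ Icc (-(Δ : ℝ)) 0)]
    have : t + h + τ.1 = t + (τ.1 + h) := by ring
    rw [this, sub_self, norm_zero]
    positivity
  · rw [max_eq_left hs.le, projIcc_of_right_le _ (by linarith : (0 : ℝ) ≤ τ.1 + h), add_zero,
      add_assoc]
    generalize hσ : h + τ.1 = σ at hs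
    have hσh : σ ≤ h := by linarith
    have hI1 := hx.intervalIntegrable ht htT
    have hI2 := hx.intervalIntegrable (t := t + σ) (by linarith) (hlt (by linarith))
    have hI3 := hI1.symm.trans hI2
    have hxσ : x (t + σ) - (x t + σ • f (seg Δ x t)) =
        ∫ s in t..t + σ, (f (seg Δ x s) - f (seg Δ x t)) := by
      rw [intervalIntegral.integral_sub hI3 intervalIntegrable_const,
        intervalIntegral.integral_const, hx.eq_add_integral ht htT,
        hx.eq_add_integral (by linarith : 0 ≤ t + σ) (hlt (by linarith)),
        ← intervalIntegral.integral_add_adjacent_intervals hI1 hI3, add_sub_cancel_left]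
      abel
    rw [hxσ]
    refine (intervalIntegral.norm_integral_le_of_norm_le_const (C := ε) fun s hs' => ?_).trans ?_
    · rw [uIoc_of_le (by linarith)] at hs'
      refine (hδε ⟨?_, by linarith [hs'.1], by linarith [hs'.2]⟩ : _ < _).le
      rw [Metric.mem_ball, Real.dist_eq, abs_of_nonneg (by linarith [hs'.1])]
      linarith [hs'.2]
    · rw [add_sub_cancel_left, abs_of_pos hs]
      gcongr

/-- Along a solution, a functional that is Lipschitz on bounded sets takes the same values up to
`o(h)` at `x_{t+h}` and at the deformation of `x_t` in the direction `f (x_t)`. -/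
theorem IsSolution₀.eventually_abs_sub_le (hf : LipOnBounded₀ f) {V : Hist Δ n → ℝ}
    (hV : LipOnBoundedV V) (hx : IsSolution₀ Δ f φ T x) {t : ℝ} (ht : 0 ≤ t)
    (htT : (t : EReal) < T) {ε : ℝ} (hε : 0 < ε) : ∀ᶠ h in 𝓝[>] (0 : ℝ),
      |V (seg Δ x (t + h)) - V (shiftSeg (seg Δ x t) (f (seg Δ x t)) h)| ≤ ε * h := by
  obtain ⟨b, htb, hbT⟩ := EReal.lt_iff_exists_real_btwn.1 htT
  have htb' : t < b := by exact_mod_cast htb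
  obtain ⟨r, hr⟩ := hx.exists_norm_seg_le hbT
  have hr0 : 0 ≤ r := (norm_nonneg _).trans (hr t ⟨ht, htb'.le⟩)
  obtain ⟨L, hL, hVL⟩ := hV (r + 1) (by linarith)
  have hεL : 0 < ε / L := by positivity
  filter_upwards [hx.eventually_norm_seg_sub_shiftSeg_le hf ht htT hεL,
    Ioo_mem_nhdsGT (lt_min (sub_pos.2 htb') (one_div_pos.2 hεL))] with h h₁ hh
  have hh0 : 0 < h := hh.1
  have hhb : t + h ≤ b := by linarith [hh.2.trans_le (min_le_left _ _)]
  have hh1 : ε / L * h ≤ 1 := by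
    rw [mul_comm, ← le_div_iff₀ hεL]
    exact (hh.2.trans_le (min_le_right _ _)).le
  have hs := hr (t + h) ⟨by linarith, hhb⟩
  refine (hVL _ _ (by linarith) ?_).trans ?_
  · have := norm_le_norm_add_norm_sub (seg Δ x (t + h))
      (shiftSeg (seg Δ x t) (f (seg Δ x t)) h)
    linarith
  · calc _ ≤ L * (ε / L * h) := by gcongr
      _ = ε * h := by field_simp

theorem IsSolution₀.le_mul_exp_of_driverD_le (hf : LipOnBounded₀ f) {V : Hist Δ n → ℝ}
    (hV : LipOnBoundedV V) {a : ℝ}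
    (hD : ∀ φ : Hist Δ n, driverD V φ (f φ) ≤ ((-(a * V φ) : ℝ) : EReal))
    (hx : IsSolution₀ Δ f φ T x) {t : ℝ} (ht : 0 ≤ t) (htT : (t : EReal) < T) :
    V (seg Δ x t) ≤ V φ * Real.exp (-a * t) := by
  have key := le_gronwallBound_of_liminf_deriv_right_le (f := fun s => V (seg Δ x s))
    (f' := fun s => -(a * V (seg Δ x s))) (δ := V φ) (K := -a) (ε := 0) (a := 0) (b := t)
    (hV.continuous.comp_continuousOn (hx.continuousOn_seg htT)) (fun s hs r hr => ?_)
    (by simp only [hx.seg_zero, le_refl]) (fun s _ => by simp) t ⟨ht, le_rfl⟩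
  · rwa [gronwallBound_ε0, sub_zero] at key
  have hsT : (s : EReal) < T := lt_trans (EReal.coe_lt_coe_iff.2 hs.2) htT
  obtain ⟨r', hr', hr'r⟩ := exists_between hr
  have h1 : ∀ᶠ h in 𝓝[>] (0 : ℝ),
      (((V (shiftSeg (seg Δ x s) (f (seg Δ x s)) h) - V (seg Δ x s)) / h : ℝ) : EReal) < r' :=
    Filter.eventually_lt_of_limsup_lt ((hD (seg Δ x s)).trans_lt (by exact_mod_cast hr'))
  have h2 := hx.eventually_abs_sub_le hf hV hs.1 hsT (half_pos (sub_pos.2 hr'r))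
  have h3 : ∀ᶠ h in 𝓝[>] (0 : ℝ), h⁻¹ * (V (seg Δ x (s + h)) - V (seg Δ x s)) < r := by
    filter_upwards [h1, h2, self_mem_nhdsWithin] with h h₁ h₂ hh
    rw [mem_Ioi] at hh
    rw [EReal.coe_lt_coe_iff, div_lt_iff₀ hh] at h₁
    rw [inv_mul_lt_iff₀ hh]
    have := (abs_le.1 h₂).2
    nlinarith [mul_pos (sub_pos.2 hr'r) hh]
  refine Filter.Eventually.frequently ?_
  have hmap : Tendsto (fun z => z - s) (𝓝[>] s) (𝓝[>] (0 : ℝ)) := by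
    refine tendsto_nhdsWithin_iff.2 ⟨?_, ?_⟩
    · have : Tendsto (fun z : ℝ => z - s) (𝓝 s) (𝓝 (s - s)) :=
        (continuous_id.sub continuous_const).tendsto s
      rw [sub_self] at this
      exact this.mono_left nhdsWithin_le_nhds
    · filter_upwards [self_mem_nhdsWithin] with z hz using mem_Ioi.2 (sub_pos.2 (mem_Ioi.1 hz))
  filter_upwards [hmap.eventually h3] with z hz
  simpa using hz

theorem GES.of_exists_LKF (hf : LipOnBounded₀ f) (hf0 : f 0 = 0) {V : Hist Δ n → ℝ}
    (hV : LipOnBoundedV V) {a₁ a₂ a p : ℝ} (ha₁ : 0 < a₁) (ha₂ : 0 < a₂) (ha : 0 < a)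
    (hp : 0 < p) (hlo : ∀ φ : Hist Δ n, a₁ * ‖ev0 φ‖ ^ p ≤ V φ)
    (hhi : ∀ φ : Hist Δ n, V φ ≤ a₂ * ‖φ‖ ^ p)
    (hD : ∀ φ : Hist Δ n, driverD V φ (f φ) ≤ ((-(a * V φ) : ℝ) : EReal)) : GES Δ f := by
  have key : ∀ (φ : Hist Δ n) (T : EReal) (x : ℝ → Vec n), IsSolution₀ Δ f φ T x →
      ∀ t : ℝ, 0 ≤ t → (t : EReal) < T →
        ‖x t‖ ≤ (a₂ / a₁) ^ (1 / p) * ‖φ‖ * Real.exp (-(a / p) * t) := by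
    intro φ T x hx t ht htT
    have h1 := hlo (seg Δ x t)
    rw [ev0_seg (hx.continuousOn_window ht htT)] at h1
    have h2 := hx.le_mul_exp_of_driverD_le hf hV hD ht htT
    have h3 : V φ * Real.exp (-a * t) ≤ a₂ * ‖φ‖ ^ p * Real.exp (-a * t) := by
      gcongr
      exact hhi φ
    refine (Real.rpow_le_rpow_iff (norm_nonneg _) (by positivity) hp).1 ?_
    rw [Real.mul_rpow (by positivity) (Real.exp_pos _).le,
      Real.mul_rpow (by positivity) (norm_nonneg _), ← Real.rpow_mul (by positivity),
      one_div_mul_cancel hp.ne', Real.rpow_one, ← Real.exp_mul]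
    have h4 : -(a / p) * t * p = -a * t := by field_simp
    rw [h4, div_mul_eq_mul_div, div_mul_eq_mul_div, le_div_iff₀ ha₁]
    linarith
  refine ⟨max 1 ((a₂ / a₁) ^ (1 / p)), le_max_left _ _, a / p, by positivity, fun φ T x hx => ?_⟩
  have hT : T = ⊤ := by
    refine hx.eq_top_of_bounded hf hf0 (R := (a₂ / a₁) ^ (1 / p) * ‖φ‖) fun t ht htT => ?_
    refine (key φ T x hx.1 t ht htT).trans (mul_le_of_le_one_right (by positivity) ?_)
    rw [Real.exp_le_one_iff]
    have : 0 < a / p := by positivity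
    nlinarith
  refine ⟨hT, fun t ht => (key φ T x hx.1 t ht (hT ▸ EReal.coe_lt_top t)).trans ?_⟩
  gcongr
  exact le_max_right _ _

theorem GES.exists_isSolution₀_top (hf : LipOnBounded₀ f) (hf0 : f 0 = 0) (h : GES Δ f) :
    ∃ K lam : ℝ, 1 ≤ K ∧ 0 < lam ∧ ∀ φ : Hist Δ n, ∃ x : ℝ → Vec n,
      IsSolution₀ Δ f φ ⊤ x ∧
        ∀ t : ℝ, 0 ≤ t → ‖seg Δ x t‖ ≤ K * ‖φ‖ * Real.exp (-lam * t) := by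
  obtain ⟨k, hk, lam, hlam, h⟩ := h
  have hlΔ : 0 ≤ lam * (Δ : ℝ) := by positivity
  refine ⟨k * Real.exp (lam * Δ), lam, ?_, hlam, fun φ => ?_⟩
  · nlinarith [Real.one_le_exp hlΔ]
  obtain ⟨T, x, hx⟩ := exists_isMaxSolution₀ hf hf0 φ
  obtain ⟨rfl, hdec⟩ := h φ T x hx
  have hxs : IsSolution₀ Δ f φ ⊤ x := hx.1
  refine ⟨x, hxs, fun t ht => ?_⟩
  refine _root_.norm_seg_le (by positivity) (hxs.continuousOn_window ht (EReal.coe_lt_top t))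
    fun s hs => ?_
  have hexp : k * Real.exp (lam * Δ) * ‖φ‖ * Real.exp (-lam * t) =
      k * ‖φ‖ * Real.exp (lam * Δ + -lam * t) := by
    rw [Real.exp_add]
    ring
  rw [hexp]
  rcases le_total s 0 with h0 | h0
  · rw [hxs.apply_nonpos ⟨by linarith [hs.1], h0⟩]
    refine (φ.norm_coe_le_norm _).trans ?_
    have h1 : 1 ≤ Real.exp (lam * Δ + -lam * t) := by
      rw [Real.one_le_exp_iff]
      nlinarith [hs.1]
    rw [mul_comm k, mul_assoc]
    exact le_mul_of_one_le_right (norm_nonneg _) (one_le_mul_of_one_le_of_one_le hk h1)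
  · refine (hdec s h0).trans ?_
    gcongr
    nlinarith [hs.1]

theorem GES.exists_coercive_LKF (hf : LipOnBounded₀ f) (hf0 : f 0 = 0) (h : GES Δ f) :
    ∃ (V : Hist Δ n → ℝ) (K μ : ℝ), 0 < K ∧ 0 < μ ∧ LipOnBoundedV V ∧
      (∀ φ, ‖φ‖ ≤ V φ) ∧ (∀ φ, V φ ≤ K * ‖φ‖) ∧
      ∀ φ, driverD V φ (f φ) ≤ ((-(μ * V φ) : ℝ) : EReal) := by
  obtain ⟨K, lam, hK, hlam, h⟩ := h.exists_isSolution₀_top hf hf0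
  choose X hX hdec using h
  set μ := lam / 2 with hμ
  have hμ0 : 0 < μ := by positivity
  have hK0 : 0 < K := by linarith
  have hW : ∀ φ t, 0 ≤ t →
      Real.exp (μ * t) * ‖seg Δ (X φ) t‖ ≤ K * ‖φ‖ * Real.exp (-μ * t) := fun φ t ht => by
    calc _ ≤ Real.exp (μ * t) * (K * ‖φ‖ * Real.exp (-lam * t)) := by
          gcongr
          exact hdec φ t ht
      _ = K * ‖φ‖ * Real.exp (μ * t + -lam * t) := by rw [Real.exp_add]; ring
      _ = _ := by rw [show μ * t + -lam * t = -μ * t by rw [hμ]; ring]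
  have hexp1 : ∀ t, 0 ≤ t → Real.exp (-μ * t) ≤ 1 := fun t ht => by
    rw [Real.exp_le_one_iff]
    nlinarith
  have hWK : ∀ φ t, 0 ≤ t → Real.exp (μ * t) * ‖seg Δ (X φ) t‖ ≤ K * ‖φ‖ := fun φ t ht =>
    (hW φ t ht).trans (mul_le_of_le_one_right (by positivity) (hexp1 t ht))
  let V : Hist Δ n → ℝ := fun φ => ⨆ t : ℝ≥0, Real.exp (μ * t) * ‖seg Δ (X φ) t‖
  have hle : ∀ φ t, 0 ≤ t → Real.exp (μ * t) * ‖seg Δ (X φ) t‖ ≤ V φ := fun φ t ht =>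
    le_ciSup (f := fun t : ℝ≥0 => Real.exp (μ * t) * ‖seg Δ (X φ) t‖)
      ⟨K * ‖φ‖, by rintro _ ⟨s, rfl⟩; exact hWK φ s s.2⟩ ⟨t, ht⟩
  have hVle : ∀ φ C, (∀ t, 0 ≤ t → Real.exp (μ * t) * ‖seg Δ (X φ) t‖ ≤ C) → V φ ≤ C :=
    fun φ C hC => ciSup_le fun t => hC t t.2
  have hlo : ∀ φ, ‖φ‖ ≤ V φ := fun φ => by
    simpa [(hX φ).seg_zero] using hle φ 0 le_rfl
  have hhi : ∀ φ, V φ ≤ K * ‖φ‖ := fun φ => hVle φ _ (hWK φ)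
  have hVL : LipOnBoundedV V := by
    intro r hr
    obtain ⟨L, hL, hfL⟩ := hf (K * r) (by positivity)
    set T := Real.log K / μ with hT
    have hT0 : 0 ≤ T := div_nonneg (Real.log_nonneg hK) hμ0.le
    have hKT : K * Real.exp (-μ * T) = 1 := by
      rw [hT, neg_mul, mul_div_cancel₀ _ hμ0.ne', Real.exp_neg, Real.exp_log hK0,
        mul_inv_cancel₀ hK0.ne']
    set C := Real.exp (μ * T) * Real.exp (L * T) with hC
    have hC1 : 1 ≤ C := one_le_mul_of_one_le_of_one_le (Real.one_le_exp (by positivity))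
      (Real.one_le_exp (by positivity))
    have hseg : ∀ φ : Hist Δ n, ‖φ‖ ≤ r → ∀ t ∈ Icc 0 T, ‖seg Δ (X φ) t‖ ≤ K * r :=
      fun φ hφ t ht => by
        have h1 : 1 ≤ Real.exp (μ * t) := Real.one_le_exp (mul_nonneg hμ0.le ht.1)
        have h2 : K * ‖φ‖ ≤ K * r := by gcongr
        exact (le_mul_of_one_le_left (norm_nonneg _) h1).trans ((hWK φ t ht.1).trans h2)
    have half : ∀ φ ψ : Hist Δ n, ‖φ‖ ≤ r → ‖ψ‖ ≤ r → V φ ≤ V ψ + C * ‖φ - ψ‖ := by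
      intro φ ψ hφ hψ
      refine hVle φ _ fun t ht => ?_
      rcases le_total t T with htT | htT
      · have h1 := (hX φ).norm_seg_sub_le (hX ψ) hL.le hfL (EReal.coe_lt_top T) (hseg φ hφ)
          (hseg ψ hψ) t ⟨ht, htT⟩
        have h2 : ‖seg Δ (X φ) t‖ ≤ ‖seg Δ (X ψ) t‖ + ‖φ - ψ‖ * Real.exp (L * t) :=
          (norm_le_norm_add_norm_sub' _ _).trans (add_le_add_right h1 _)
        calc _ ≤ Real.exp (μ * t) * (‖seg Δ (X ψ) t‖ + ‖φ - ψ‖ * Real.exp (L * t)) := by gcongr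
          _ = Real.exp (μ * t) * ‖seg Δ (X ψ) t‖ +
              Real.exp (μ * t) * Real.exp (L * t) * ‖φ - ψ‖ := by ring
          _ ≤ _ := by
            refine add_le_add (hle ψ t ht) ?_
            rw [hC]
            gcongr
      · have h1 : K * Real.exp (-μ * t) ≤ 1 := by
          rw [← hKT]
          gcongr K * Real.exp ?_
          nlinarith
        calc _ ≤ K * Real.exp (-μ * t) * ‖φ‖ := by
              rw [mul_right_comm]
              exact hW φ t ht
          _ ≤ ‖φ‖ := mul_le_of_le_one_left (norm_nonneg _) h1
          _ ≤ ‖ψ‖ + ‖φ - ψ‖ := norm_le_norm_add_norm_sub' _ _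
          _ ≤ _ := add_le_add (hlo ψ) (le_mul_of_one_le_left (norm_nonneg _) hC1)
    refine ⟨C, by linarith, fun φ ψ hφ hψ => abs_sub_le_iff.2 ⟨?_, ?_⟩⟩
    · linarith [half φ ψ hφ hψ]
    · rw [norm_sub_rev]
      linarith [half ψ φ hψ hφ]
  have hflow : ∀ φ s, 0 ≤ s → V (seg Δ (X φ) s) ≤ Real.exp (-(μ * s)) * V φ := by
    intro φ s hs
    refine hVle _ _ fun t ht => ?_
    have hsol := (hX φ).shift hf hs
    have h1 : seg Δ (X (seg Δ (X φ) s)) t = seg Δ (X φ) (t + s) := by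
      rw [seg_eq_of_eq_of_lt (T := ⊤) (fun r hr hrT => (hX _).eq hf hsol hr hrT) ht
        (EReal.coe_lt_top t)]
      ext1 τ
      rw [seg_apply (hsol.continuousOn_window ht (EReal.coe_lt_top t)),
        seg_apply ((hX φ).continuousOn_window (by linarith) (EReal.coe_lt_top _)),
        add_right_comm]
    have h2 : Real.exp (μ * t) = Real.exp (-(μ * s)) * Real.exp (μ * (t + s)) := by
      rw [← Real.exp_add]
      ring_nf
    rw [h1, h2, mul_assoc]
    gcongr
    exact hle φ (t + s) (by linarith)
  refine ⟨V, K, μ, hK0, hμ0, hVL, hlo, hhi, fun φ => ?_⟩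
  refine EReal.le_of_forall_lt_iff_le.1 fun z hz => ?_
  have hz' : -(μ * V φ) < z := by exact_mod_cast hz
  set ε := (z + μ * V φ) / 2 with hε
  have hε0 : 0 < ε := by
    rw [hε]
    linarith
  have h1 := (hX φ).eventually_abs_sub_le hf hVL le_rfl (EReal.coe_lt_top 0) hε0
  have h2 : ∀ᶠ s in 𝓝[>] (0 : ℝ), (Real.exp (-(μ * s)) - 1) / s < -μ + ε / (V φ + 1) := by
    have hd : HasDerivAt (fun s : ℝ => Real.exp (-(μ * s))) (-μ) 0 := by
      simpa using (((hasDerivAt_id (0 : ℝ)).const_mul μ).neg).exp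
    have hpos : 0 < ε / (V φ + 1) :=
      div_pos hε0 (by linarith [(norm_nonneg φ).trans (hlo φ)])
    filter_upwards [hd.tendsto_slope_zero_right.eventually_lt_const
      (by linarith : -μ < -μ + ε / (V φ + 1))] with s hs
    simpa [div_eq_inv_mul] using hs
  refine Filter.limsup_le_of_le (h := ?_)
  filter_upwards [h1, h2, self_mem_nhdsWithin] with s h₁ h₂ hs
  rw [mem_Ioi] at hs
  rw [(hX φ).seg_zero, zero_add] at h₁
  have h₃ := (abs_le.1 h₁).1
  have h₄ := hflow φ s hs.le
  have hV0 : 0 ≤ V φ := (norm_nonneg φ).trans (hlo φ)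
  rw [EReal.coe_le_coe_iff, div_le_iff₀ hs]
  rw [div_lt_iff₀ hs] at h₂
  have h₅ : ε / (V φ + 1) * V φ ≤ ε := by
    rw [div_mul_eq_mul_div, div_le_iff₀ (by linarith)]
    nlinarith
  have h₆ := mul_le_mul_of_nonneg_right h₂.le hV0
  have h₇ := mul_le_mul_of_nonneg_right h₅ hs.le
  have h₈ : z = -(μ * V φ) + 2 * ε := by
    rw [hε]
    ring
  rw [h₈]
  linarith

end Solutions

/-- LKF characterization of GES. -/
theorem ges_LKF_characterization
    (Δ : ℝ≥0) (n : ℕ) (f₀ : Hist Δ n → Vec n)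
    (hf : LipOnBounded₀ f₀) (hf0 : f₀ 0 = 0) :
    List.TFAE
      [GES Δ f₀,
       ∃ V : Hist Δ n → ℝ, (∀ φ, 0 ≤ V φ) ∧ LipOnBoundedV V ∧
         ∃ a₁ a₂ a p : ℝ, 0 < a₁ ∧ 0 < a₂ ∧ 0 < a ∧ 0 < p ∧
           (∀ φ : Hist Δ n, a₁ * ‖ev0 φ‖ ^ p ≤ V φ ∧ V φ ≤ a₂ * ‖φ‖ ^ p) ∧
           ∀ φ : Hist Δ n, driverD V φ (f₀ φ) ≤ ((-(a * V φ) : ℝ) : EReal),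
       ∃ V : Hist Δ n → ℝ, (∀ φ, 0 ≤ V φ) ∧ LipOnBoundedV V ∧
         ∃ a₁ a₂ a p : ℝ, 0 < a₁ ∧ 0 < a₂ ∧ 0 < a ∧ 0 < p ∧
           (∀ φ : Hist Δ n, a₁ * ‖φ‖ ^ p ≤ V φ ∧ V φ ≤ a₂ * ‖φ‖ ^ p) ∧
           ∀ φ : Hist Δ n, driverD V φ (f₀ φ) ≤ ((-(a * ‖φ‖ ^ p) : ℝ) : EReal)] := by
  tfae_have 1 → 3 := by
    intro h
    obtain ⟨V, K, μ, hK, hμ, hVL, hlo, hhi, hD⟩ := h.exists_coercive_LKF hf hf0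
    refine ⟨V, fun φ => (norm_nonneg φ).trans (hlo φ), hVL, 1, K, μ, 1, one_pos, hK, hμ, one_pos,
      fun φ => ?_, fun φ => (hD φ).trans ?_⟩
    · simpa using ⟨hlo φ, hhi φ⟩
    · rw [EReal.coe_le_coe_iff, Real.rpow_one]
      exact neg_le_neg (mul_le_mul_of_nonneg_left (hlo φ) hμ.le)
  tfae_have 3 → 2 := by
    rintro ⟨V, hV0, hVL, a₁, a₂, a, p, ha₁, ha₂, ha, hp, hb, hD⟩
    refine ⟨V, hV0, hVL, a₁, a₂, a / a₂, p, ha₁, ha₂, by positivity, hp, fun φ => ⟨?_, (hb φ).2⟩,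
      fun φ => (hD φ).trans ?_⟩
    · refine le_trans ?_ (hb φ).1
      gcongr
      exact norm_ev0_le φ
    · rw [EReal.coe_le_coe_iff, neg_le_neg_iff, div_mul_eq_mul_div, div_le_iff₀ ha₂]
      calc _ ≤ a * (a₂ * ‖φ‖ ^ p) := by
            gcongr
            exact (hb φ).2
        _ = _ := by ring
  tfae_have 2 → 1 := by
    rintro ⟨V, -, hVL, a₁, a₂, a, p, ha₁, ha₂, ha, hp, hb, hD⟩
    exact GES.of_exists_LKF hf hf0 hVL ha₁ ha₂ ha hp (fun φ => (hb φ).1) (fun φ => (hb φ).2) hD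
  tfae_finish
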